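/- Let X be a δ-hyperbolic metric space (for some δ ≥ 0) satisfying condition (EB): there exist L, λ > 0 and R₀ > 0 such that |d(x,y)+d(z,t)−d(x,t)−d(z,y)| ≤ L·exp(−λR) whenever x, y, z, t ∈ X satisfy d(x,y)+d(z,t)−d(x,z)−d(y,t) ≥ R ≥ R₀. Then X is strongly hyperbolic with some parameter ε > 0; in fact any ε ≤ min{2λ, 2/L, 1/(2δ), (2 log 2)/R₀} works. -/

import Mathlib

/-- The Gromov product of `x` and `y` with respect to the basepoint `o`:
`(x,y)_o = (d(x,o) + d(y,o) - d(x,y)) / 2`. -/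
noncomputable def gromovProduct {X : Type*} [MetricSpace X] (o x y : X) : ℝ :=
  (dist x o + dist y o - dist x y) / 2

/-- A metric space `X` is *strongly hyperbolic* with parameter `ε > 0` if
`exp(-ε (x,y)_o) ≤ exp(-ε (x,z)_o) + exp(-ε (z,y)_o)` for all `x, y, z, o ∈ X`. -/
def StronglyHyperbolicWith (X : Type*) [MetricSpace X] (ε : ℝ) : Prop :=
  ∀ x y z o : X,
    Real.exp (-ε * gromovProduct o x y) ≤
      Real.exp (-ε * gromovProduct o x z) + Real.exp (-ε * gromovProduct o z y)

/-- If `b ≥ 0` and `a ≤ L e^{-λ b}`, then `1 ≤ e^{-ε b / 2} + e^{-ε a / 2}` for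
`0 < ε ≤ min {2λ, 2/L}`. -/
theorem one_le_exp_add_exp_of_le_mul_exp {L lam ε a b : ℝ} (hL : 0 < L) (hε : 0 < ε)
    (hεlam : ε ≤ 2 * lam) (hεL : ε ≤ 2 / L) (hb : 0 ≤ b) (ha : a ≤ L * Real.exp (-lam * b)) :
    1 ≤ Real.exp (-ε * b / 2) + Real.exp (-ε * a / 2) := by
  have hlin : -ε * a / 2 + 1 ≤ Real.exp (-ε * a / 2) := Real.add_one_le_exp _
  have hexp : Real.exp (-lam * b) ≤ Real.exp (-ε * b / 2) := Real.exp_le_exp.2 (by nlinarith)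
  have hεL' : ε * L ≤ 2 := (le_div_iff₀ hL).1 hεL
  have hmul : ε * a ≤ 2 * Real.exp (-lam * b) :=
    calc ε * a ≤ ε * (L * Real.exp (-lam * b)) := by gcongr
      _ = ε * L * Real.exp (-lam * b) := by ring
      _ ≤ 2 * Real.exp (-lam * b) := by gcongr
  linarith

/-- If `ε R₀ ≤ 2 log 2` and `a ≤ R₀`, then `e^{-ε a / 2} ≥ 1 / 2`. -/
theorem half_le_exp_of_le {R₀ ε a : ℝ} (hε : 0 < ε) (hεR : ε * R₀ ≤ 2 * Real.log 2)
    (ha : a ≤ R₀) : 1 / 2 ≤ Real.exp (-ε * a / 2) :=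
  calc (1 / 2 : ℝ) = Real.exp (-Real.log 2) := by
        rw [Real.exp_neg, Real.exp_log two_pos, one_div]
    _ ≤ Real.exp (-ε * a / 2) := Real.exp_le_exp.2 (by nlinarith)

/-- Strong hyperbolicity with parameter `ε` follows from the four-point inequality
`1 ≤ e^{-ε (A - B) / 2} + e^{-ε (A - C) / 2}`, where `A`, `B`, `C` are the three sums of
opposite distances of a quadruple of points. -/
theorem stronglyHyperbolicWith_of_four_point {X : Type*} [MetricSpace X] {ε : ℝ}
    (h : ∀ x y z o : X,
      1 ≤ Real.exp (-ε * (dist x y + dist z o - dist x z - dist y o) / 2) +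
        Real.exp (-ε * (dist x y + dist z o - dist x o - dist z y) / 2)) :
    StronglyHyperbolicWith X ε := by
  intro x y z o
  have hxz : -ε * gromovProduct o x z = -ε * gromovProduct o x y +
      -ε * (dist x y + dist z o - dist x z - dist y o) / 2 := by
    simp only [gromovProduct]; ring
  have hzy : -ε * gromovProduct o z y = -ε * gromovProduct o x y +
      -ε * (dist x y + dist z o - dist x o - dist z y) / 2 := by
    simp only [gromovProduct]; ring
  rw [hxz, hzy, Real.exp_add, Real.exp_add, ← mul_add]
  exact le_mul_of_one_le_right (Real.exp_pos _).le (h x y z o)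

/-- Condition (EB) alone implies strong hyperbolicity with any parameter
`0 < ε ≤ min {2λ, 2/L, (2 log 2)/R₀}`. -/
theorem stronglyHyperbolicWith_of_eb {X : Type*} [MetricSpace X] {L lam R₀ ε : ℝ}
    (hL : 0 < L) (hR₀ : 0 < R₀)
    (hEB : ∀ x y z t : X, ∀ R : ℝ, R₀ ≤ R →
      R ≤ dist x y + dist z t - dist x z - dist y t →
      |dist x y + dist z t - dist x t - dist z y| ≤ L * Real.exp (-lam * R))
    (hε : 0 < ε) (hεlam : ε ≤ 2 * lam) (hεL : ε ≤ 2 / L) (hεR : ε ≤ 2 * Real.log 2 / R₀) :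
    StronglyHyperbolicWith X ε := by
  refine stronglyHyperbolicWith_of_four_point fun x y z o => ?_
  rcases le_total R₀ (dist x y + dist z o - dist x z - dist y o) with hB | hB
  · exact one_le_exp_add_exp_of_le_mul_exp hL hε hεlam hεL (hR₀.le.trans hB)
      ((le_abs_self _).trans (hEB x y z o _ hB le_rfl))
  rcases le_total R₀ (dist x y + dist z o - dist x o - dist z y) with hC | hC
  · have key := hEB y x z o _ hC (by rw [dist_comm y x, dist_comm y z]; linarith)
    rw [dist_comm y x, dist_comm z x] at key
    rw [add_comm]
    exact one_le_exp_add_exp_of_le_mul_exp hL hε hεlam hεL (hR₀.le.trans hC)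
      (by linarith [le_abs_self (dist x y + dist z o - dist y o - dist x z)])
  · have hεR' : ε * R₀ ≤ 2 * Real.log 2 := (le_div_iff₀ hR₀).1 hεR
    linarith [half_le_exp_of_le hε hεR' hB, half_le_exp_of_le hε hεR' hC]

/-- a `δ`-hyperbolic space satisfying condition (EB) is strongly hyperbolic
with some parameter `ε > 0`; in fact any
`ε ≤ min {2λ, 2/L, 1/(2δ), (2 log 2)/R₀}` works. -/
theorem eb_implies_strongly_hyperbolic {X : Type*} [MetricSpace X] {δ : ℝ} (hδ : 0 ≤ δ)
    (hhyp : ∀ x y z o : X,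
      gromovProduct o x y ≥ min (gromovProduct o x z) (gromovProduct o y z) - δ)
    {L lam R₀ : ℝ} (hL : 0 < L) (hlam : 0 < lam) (hR₀ : 0 < R₀)
    (hEB : ∀ x y z t : X, ∀ R : ℝ, R₀ ≤ R →
      R ≤ dist x y + dist z t - dist x z - dist y t →
      |dist x y + dist z t - dist x t - dist z y| ≤ L * Real.exp (-lam * R)) :
    (∃ ε > (0 : ℝ), StronglyHyperbolicWith X ε) ∧
      ∀ ε : ℝ, 0 < ε →
        ε ≤ min (min (2 * lam) (2 / L)) (min (1 / (2 * δ)) (2 * Real.log 2 / R₀)) →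
        StronglyHyperbolicWith X ε := by
  constructor
  · have hlog : 0 < Real.log 2 := Real.log_pos one_lt_two
    refine ⟨min (min (2 * lam) (2 / L)) (2 * Real.log 2 / R₀), by positivity, ?_⟩
    exact stronglyHyperbolicWith_of_eb hL hR₀ hEB (by positivity)
      ((min_le_left _ _).trans (min_le_left _ _)) ((min_le_left _ _).trans (min_le_right _ _))
      (min_le_right _ _)
  · intro ε hε hle
    obtain ⟨⟨hεlam, hεL⟩, -, hεR⟩ := by simpa only [le_min_iff] using hle
    exact stronglyHyperbolicWith_of_eb hL hR₀ hEB hε hεlam hεL hεR
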